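/- Let T1 ∈ T_{n+1} be a type class of length n+1, let b, c ∈ A, and set T2 = T_b(T1) and T3 = T_c(T1). If T2 and T3 are regarded as sets of length-n sequences (so T3 ∈ T_n when nonempty), then there exists u ∈ A^{k+1} such that |T2| ≥ |T_u(T3)|. -/

import Mathlib

open Finset

/-- `Finset.filter` with classical decidability. -/
noncomputable def sfilter {α : Type*} (p : α → Prop) (s : Finset α) : Finset α :=
  @Finset.filter α p (Classical.decPred p) s

/-- The finset of all strings of length `n` over the alphabet `A`. -/
def lists (A : Type*) [Fintype A] [DecidableEq A] : ℕ → Finset (List A)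
  | 0 => {[]}
  | n + 1 => Finset.image₂ List.cons Finset.univ (lists A n)

/-- Symbol at (0-indexed) integer position `j` of the string `x`, where negative
positions `-k, …, -1` are given by the fixed initial state `s0`. -/
def symL {A : Type*} [Inhabited A] (k : ℕ) (s0 : Fin k → A) (x : List A) (j : ℤ) : A :=
  if h : 0 ≤ j then
    (if h2 : j.toNat < x.length then x.get ⟨j.toNat, h2⟩ else default)
  else
    (if h3 : (j + k).toNat < k then s0 ⟨(j + k).toNat, h3⟩ else default)

/-- The state (context of order `k`) preceding position `t` of the string `x`. -/
def ctxL {A : Type*} [Inhabited A] (k : ℕ) (s0 : Fin k → A) (x : List A)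
    (t : ℕ) : Fin k → A :=
  fun i => symL k s0 x ((t : ℤ) - (k : ℤ) + (i : ℤ))

/-- `n_{sa}(x)`: number of occurrences of symbol `a` in state `s` within `x`. -/
noncomputable def countL {A : Type*} [Inhabited A] [DecidableEq A] (k : ℕ)
    (s0 : Fin k → A) (s : Fin k → A) (a : A) (x : List A) : ℕ :=
  (sfilter (fun t : Fin x.length => ctxL k s0 x t = s ∧ x.get t = a) Finset.univ).card

/-- Two strings have the same `k`-th order type. -/
def sameTypeL {A : Type*} [Inhabited A] [DecidableEq A] (k : ℕ) (s0 : Fin k → A)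
    (x y : List A) : Prop :=
  x.length = y.length ∧
    ∀ (s : Fin k → A) (a : A), countL k s0 s a x = countL k s0 s a y

/-- The type class `T(x)` as a finset of strings of length `|x|`. -/
noncomputable def typeClassL {A : Type*} [Fintype A] [DecidableEq A] [Inhabited A]
    (k : ℕ) (s0 : Fin k → A) (x : List A) : Finset (List A) :=
  sfilter (fun y => sameTypeL k s0 x y) (lists A x.length)

/-- Probability `P(x) = ∏_t p(x_t | state)` of the string `x`. -/
noncomputable def seqProbL {A : Type*} [Inhabited A] (k : ℕ) (s0 : Fin k → A)
    (p : (Fin k → A) → A → ℝ) (x : List A) : ℝ :=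
  ∏ t : Fin x.length, p (ctxL k s0 x t) (x.get t)

/-- `p` is a (strictly positive) `k`-th order Markov kernel. -/
def IsMarkov {A : Type*} [Fintype A] (k : ℕ) (p : (Fin k → A) → A → ℝ) : Prop :=
  (∀ s a, 0 < p s a) ∧ ∀ s, ∑ a : A, p s a = 1

/-- A prefix-free set of strings. -/
def PrefixFree {A : Type*} (D : Set (List A)) : Prop :=
  ∀ x ∈ D, ∀ y ∈ D, x <+: y → x = y

/-- A complete dictionary: prefix-free, and every string either has a prefix in `D`
or is a prefix of a string in `D`. -/
def CompleteDict {A : Type*} (D : Set (List A)) : Prop :=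
  PrefixFree D ∧ ∀ z : List A, (∃ x ∈ D, x <+: z) ∨ (∃ y ∈ D, z <+: y)

/-- `D ∩ A^n` as a finset. -/
noncomputable def dictAt {A : Type*} [Fintype A] [DecidableEq A]
    (D : Set (List A)) (n : ℕ) : Finset (List A) :=
  sfilter (fun x => x ∈ D) (lists A n)

/-- The failure set at level `n`: strings of length `n` with no prefix in `D`. -/
noncomputable def failAt {A : Type*} [Fintype A] [DecidableEq A]
    (D : Set (List A)) (n : ℕ) : Finset (List A) :=
  sfilter (fun x => ¬ ∃ y ∈ D, y <+: x) (lists A n)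

/-- The failure part of a finite set `T` of strings: members with no prefix in `D`. -/
noncomputable def failIn {A : Type*} (D : Set (List A)) (T : Finset (List A)) :
    Finset (List A) :=
  sfilter (fun x => ¬ ∃ y ∈ D, y <+: x) T

/-- The VFR `(D, ξ, M)` is perfect for the process `p` (at every level `n`,
equivalently at every truncation level): conditioned on `X^n ∈ D ∩ A^n`
(whenever nonempty), `ξ(X^n)` is uniform on `{0, …, M−1}`. -/
def PerfectVFR {A : Type*} [Fintype A] [DecidableEq A] [Inhabited A] (k : ℕ)
    (s0 : Fin k → A) (p : (Fin k → A) → A → ℝ) (D : Set (List A))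
    (ξ : List A → ℕ) (M : ℕ) : Prop :=
  ∀ n : ℕ, (dictAt (A := A) D n).Nonempty →
    ∀ r < M,
      (∑ x ∈ sfilter (fun x => ξ x = r) (dictAt (A := A) D n), seqProbL k s0 p x)
        = (∑ x ∈ dictAt (A := A) D n, seqProbL k s0 p x) / (M : ℝ)

/-- `T_u(T)`: the prefixes of length `n − ℓ` of the members `z` of `T` (strings of
length `n`) whose symbols at positions `n−k−ℓ+1, …, n−k` (1-indexed, with the
initial-state convention for nonpositive indices) form the string `u` (of length `ℓ`). -/
noncomputable def TcutSet {A : Type*} [DecidableEq A] [Inhabited A] (k : ℕ) (s0 : Fin k → A)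
    (T : Finset (List A)) (u : List A) : Finset (List A) :=
  Finset.image (fun z => z.take (z.length - u.length))
    (sfilter (fun z => u.length ≤ z.length ∧
      ∀ i : Fin u.length,
        symL k s0 z ((z.length : ℤ) - (k : ℤ) - (u.length : ℤ) + (i : ℤ)) = u.get i) T)

/-- Number of occurrences of the word `g` as a factor of `L`. -/
def occ {A : Type*} [DecidableEq A] (g : List A) : List A → ℕ
  | [] => if g <+: [] then 1 else 0
  | a :: L => (if g <+: a :: L then 1 else 0) + occ g L

section Occurrences

variable {A : Type*} [DecidableEq A]

lemma occ_eq_zero_of_length_lt {g L : List A} (h : L.length < g.length) : occ g L = 0 := by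
  induction L with
  | nil => simp [occ]; rintro rfl; simp at h
  | cons a L ih =>
    simp only [List.length_cons] at h
    rw [occ, ih (by omega), if_neg]
    intro hp
    have := hp.length_le
    simp at this; omega

lemma exists_append_of_occ_pos {g L : List A} (h : 0 < occ g L) :
    ∃ X Y, L = X ++ (g ++ Y) := by
  induction L with
  | nil =>
    rw [occ] at h
    split_ifs at h with hp
    · exact ⟨[], [], by simpa using (List.prefix_nil.1 hp).symm⟩
    · omega
  | cons a L ih =>
    rw [occ] at h
    split_ifs at h with hp
    · obtain ⟨Y, hY⟩ := hp
      exact ⟨[], Y, by simpa using hY.symm⟩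
    · obtain ⟨X, Y, rfl⟩ := ih (by omega)
      exact ⟨a :: X, Y, rfl⟩

lemma occ_append_right_pos (g X : List A) : 0 < occ g (X ++ g) := by
  induction X with
  | nil => cases g <;> simp [occ]
  | cons a X ih => rw [List.cons_append, occ]; omega

/-- Words of length `k + 1` are counted additively along two lists overlapping in `k` letters. -/
lemma occ_append_overlap {g q : List A} (hg : g.length = q.length + 1) (P R : List A) :
    occ g (P ++ (q ++ R)) = occ g (P ++ q) + occ g (q ++ R) := by
  induction P with
  | nil => simp [occ_eq_zero_of_length_lt (g := g) (L := q) (by omega)]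
  | cons a P ih =>
    have : g <+: a :: (P ++ (q ++ R)) ↔ g <+: a :: (P ++ q) := by
      rw [← List.append_assoc, ← List.cons_append]
      refine ⟨fun h => ?_, fun h => h.trans (List.prefix_append _ _)⟩
      exact List.prefix_of_prefix_length_le h (List.prefix_append _ _) (by simp; omega)
    simp only [List.cons_append, occ, ih, this]
    omega

lemma occ_eq_prefix_add_sum [Fintype A] (h L : List A) :
    occ h L = (if h <+: L then 1 else 0) + ∑ a : A, occ (a :: h) L := by
  induction L with
  | nil => simp [occ]
  | cons x L ih =>
    have : ∑ a : A, (if a :: h <+: x :: L then 1 else 0) = if h <+: L then 1 else 0 := by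
      simp only [List.cons_prefix_cons, ite_and, Finset.sum_ite_eq', Finset.mem_univ, if_true]
    simp only [occ, Finset.sum_add_distrib, this, ← ih]

lemma occ_eq_suffix_add_sum [Fintype A] (h L : List A) :
    occ h L = (if h <:+ L then 1 else 0) + ∑ a : A, occ (h ++ [a]) L := by
  induction L with
  | nil => simp [occ]
  | cons x L ih =>
    have : (if h <+: x :: L then 1 else 0) + (if h <:+ L then 1 else 0) =
        (if h <:+ x :: L then 1 else 0) +
          ∑ a : A, (if h ++ [a] <+: x :: L then 1 else 0) := by
      by_cases hp : h <+: x :: L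
      · obtain ⟨R, hR⟩ := hp
        rw [← hR]
        simp only [List.prefix_append, if_true, List.prefix_append_right_inj]
        cases R with
        | nil =>
          have : ¬ h <:+ L := fun hs => by
            have := hs.length_le
            simp at hR; subst hR; simp at this
          simp [this]
        | cons r R =>
          have : h <:+ h ++ r :: R ↔ h <:+ L := by
            rw [hR]
            refine ⟨fun hs => ?_, fun hs => hs.trans (List.suffix_cons _ _)⟩
            refine List.suffix_of_suffix_length_le hs (List.suffix_cons _ _) ?_
            have := congrArg List.length hR
            simp at this; omega
          simp only [this]
          simp [List.cons_prefix_cons, add_comm]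
      · have h1 : ∀ a, ¬ h ++ [a] <+: x :: L := fun a ha =>
          hp ((List.prefix_append _ _).trans ha)
        have : h <:+ x :: L ↔ h <:+ L := by
          rw [List.suffix_cons_iff, or_iff_right]
          rintro rfl; exact hp List.prefix_rfl
        simp [hp, h1, this]
    simp only [occ, Finset.sum_add_distrib]
    omega

/-- Lists with a common initial word of length `k` and equal counts of words of length `k + 1`
end in the same word of length `k`. -/
lemma suffix_of_occ_eq [Fintype A] {S p x y : List A} (hS : S.length = p.length)
    (hocc : ∀ g : List A, g.length = p.length + 1 → occ g (S ++ x) = occ g (S ++ y))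
    (hp : p <:+ S ++ x) : p <:+ S ++ y := by
  have hpre : ∀ z, p <+: S ++ z ↔ p = S := fun z =>
    ⟨fun h => (List.prefix_of_prefix_length_le h (List.prefix_append S z) hS.ge).eq_of_length
      hS.symm, fun h => h ▸ List.prefix_append _ _⟩
  have h1 : occ p (S ++ x) = occ p (S ++ y) := by
    rw [occ_eq_prefix_add_sum p (S ++ x), occ_eq_prefix_add_sum p (S ++ y)]
    simp only [hpre]
    congr 1
    exact Finset.sum_congr rfl fun a _ => hocc _ (by simp)
  rw [occ_eq_suffix_add_sum p (S ++ x), occ_eq_suffix_add_sum p (S ++ y),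
    Finset.sum_congr rfl fun a _ => hocc (p ++ [a]) (by simp), if_pos hp] at h1
  by_contra hn
  rw [if_neg hn] at h1
  omega

lemma occ_eq_sum_range {g : List A} (hg : g ≠ []) (L : List A) :
    occ g L = ∑ i ∈ Finset.range L.length, if g <+: L.drop i then 1 else 0 := by
  induction L with
  | nil => simp [occ, hg]
  | cons a L ih => rw [List.length_cons, Finset.sum_range_succ', occ, ih]; simp [add_comm]

/-- Exchanging two consecutive cycles at the state `p` preserves the counts of words of length
`k + 1`. -/
lemma occ_swap_cycles {g p P w₂ : List A} {c e : A} (hg : g.length = p.length + 1)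
    (hp : p <:+ p ++ (w₂ ++ [e])) :
    occ g (P ++ p ++ (w₂ ++ e :: c :: p)) = occ g (P ++ p ++ (c :: p ++ (w₂ ++ [e]))) := by
  obtain ⟨Q, hQ⟩ := hp
  have h1 : occ g (P ++ p ++ (w₂ ++ e :: c :: p)) =
      occ g (P ++ p) + (occ g (Q ++ p) + occ g (p ++ c :: p)) := by
    rw [← occ_append_overlap hg Q, ← List.append_assoc Q, hQ, List.append_assoc P,
      occ_append_overlap hg P]
    simp
  have h2 : occ g (P ++ p ++ (c :: p ++ (w₂ ++ [e]))) =
      occ g (P ++ p) + (occ g (p ++ c :: p) + occ g (Q ++ p)) := by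
    rw [hQ, List.append_assoc P,
      occ_append_overlap hg P]
    have := occ_append_overlap hg (p ++ [c]) (w₂ ++ [e])
    simp only [List.append_assoc, List.cons_append, List.nil_append] at this ⊢
    rw [this]
  rw [h1, h2, add_comm (occ g (Q ++ p))]

/-- If the state `p` is not visited before the last letter of `w ++ [e]`, then `p` can only be
entered there, from the state that is visited just before. -/
lemma occ_cons_eq_zero {S p w : List A} {b b' e : A} (hS : S.length = p.length) (hb : b' ≠ b)
    (hw : ∀ j ≤ w.length, ¬ p <:+ S ++ w.take j) (hbp : b :: p <:+ S ++ (w ++ [e])) :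
    occ (b' :: p) (S ++ (w ++ [e])) = 0 := by
  by_contra hpos
  obtain ⟨X, Y, hXY⟩ := exists_append_of_occ_pos (Nat.pos_of_ne_zero hpos)
  obtain rfl | ⟨Y, y, rfl⟩ := List.eq_nil_or_concat' Y
  · have h1 : b' :: p <:+ S ++ (w ++ [e]) := ⟨X, by rw [hXY, List.append_nil]⟩
    have := (List.suffix_of_suffix_length_le h1 hbp (by simp)).eq_of_length (by simp)
    exact hb (List.cons_eq_cons.1 this).1
  · rw [← List.append_assoc, ← List.append_assoc, ← List.append_assoc] at hXY
    have h2 := (List.append_inj' hXY rfl).1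
    have hlen := congrArg List.length h2
    simp at hlen
    refine hw (w.length - Y.length) (by omega) ?_
    have h3 := congrArg (List.take (X.length + (p.length + 1))) h2
    rw [List.take_left' (l₁ := X ++ b' :: p) (by simp), List.take_append,
      List.take_of_length_le (by omega)] at h3
    have : X.length + (p.length + 1) - S.length = w.length - Y.length := by omega
    rw [this] at h3
    rw [h3]
    exact (List.suffix_cons _ _).trans (List.suffix_append _ _)

end Occurrences

section Translation

variable {A : Type*} [Inhabited A] (k : ℕ) (s0 : Fin k → A)

lemma symL_sub_eq_getD (x : List A) (i : ℕ) :
    symL k s0 x ((i : ℤ) - k) = (List.ofFn s0 ++ x).getD i default := by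
  unfold symL
  by_cases hi : i < k
  · rw [dif_neg (by omega), dif_pos (by omega), List.getD_append _ _ _ _ (by simpa using hi)]
    simp [hi]
  · rw [dif_pos (by omega), List.getD_append_right _ _ _ _ (by simpa using hi)]
    have : ((i : ℤ) - k).toNat = i - k := by omega
    simp only [this, List.length_ofFn]
    split_ifs with h
    · simp [h]
    · simp at h; simp [h]

lemma prefix_drop_iff_getD {g L : List A} {t : ℕ} (h : t + g.length ≤ L.length) :
    g <+: L.drop t ↔ ∀ i : Fin g.length, L.getD (t + i) default = g.get i := by
  rw [List.prefix_iff_eq_take]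
  constructor
  · intro e i
    have h1 : g[(i : ℕ)]? = ((L.drop t).take g.length)[(i : ℕ)]? := by rw [← e]
    simp only [List.getElem?_take, i.2, if_true, List.getElem?_drop] at h1
    rw [List.getD_eq_getElem?_getD, ← h1]
    simp
  · intro e
    apply List.ext_getElem
    · simp; omega
    · intro i hi _
      have := e ⟨i, hi⟩
      rw [List.getD_eq_getElem _ _ (by omega)] at this
      simpa using this.symm

/-- The condition on `z` in the definition of `TcutSet`, when the last `k` letters are known. -/
lemma forall_symL_iff_suffix {p z u : List A} (hp : p.length = k)
    (hz : p <:+ List.ofFn s0 ++ z) (hu : u.length ≤ z.length) :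
    (∀ i : Fin u.length,
      symL k s0 z ((z.length : ℤ) - (k : ℤ) - (u.length : ℤ) + (i : ℤ)) = u.get i) ↔
      u ++ p <:+ List.ofFn s0 ++ z := by
  obtain ⟨V, hV⟩ := hz
  have hlen := congrArg List.length hV
  simp [hp] at hlen
  have h1 : ∀ i : Fin u.length,
      symL k s0 z ((z.length : ℤ) - (k : ℤ) - (u.length : ℤ) + (i : ℤ)) =
        V.getD (z.length - u.length + i) default := fun i => by
    have hi := i.2
    have : ((z.length : ℤ) - (k : ℤ) - (u.length : ℤ) + (i : ℤ)) =
      ((z.length - u.length + i : ℕ) : ℤ) - k := by push_cast [hu]; ring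
    rw [this, symL_sub_eq_getD, ← hV, List.getD_append _ _ _ _ (by omega)]
  simp only [h1]
  rw [← prefix_drop_iff_getD (by omega), ← hV, List.suffix_append_self_iff]
  constructor
  · intro h
    rw [h.eq_of_length (by simp; omega)]
    exact List.drop_suffix _ _
  · rintro ⟨W, rfl⟩
    simp at hlen
    rw [List.drop_left' (by omega)]

variable [DecidableEq A]

lemma countL_eq_occ (s : Fin k → A) (a : A) (x : List A) :
    countL k s0 s a x = occ (List.ofFn s ++ [a]) (List.ofFn s0 ++ x) := by
  rw [occ_eq_sum_range (by simp), List.length_append, add_comm, Finset.sum_range_add,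
    Finset.sum_eq_zero (s := Finset.range (List.ofFn s0).length), add_zero,
    ← Fin.sum_univ_eq_sum_range
      (fun i => if List.ofFn s ++ [a] <+: (List.ofFn s0 ++ x).drop i then 1 else 0), countL,
    sfilter, Finset.card_filter]
  · refine Finset.sum_congr rfl fun t _ => ?_
    have ht := t.2
    congr 1
    rw [prefix_drop_iff_getD (by simp; omega), eq_iff_iff, funext_iff]
    have hc : ∀ i : Fin k, ctxL k s0 x t i =
        (List.ofFn s0 ++ x).getD (t + i) default := fun i => by
      rw [← symL_sub_eq_getD, ctxL]; congr 1; push_cast; ring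
    have hx : x.get t = (List.ofFn s0 ++ x).getD (t + k) default := by
      rw [List.getD_append_right _ _ _ _ (by simp)]; simp
    simp only [hc, hx]
    constructor
    · rintro ⟨h1, h2⟩ ⟨i, hi⟩
      simp at hi
      rcases hi.lt_or_eq with hi' | rfl
      · simpa [List.getElem_append, hi'] using h1 ⟨i, hi'⟩
      · simpa [List.getElem_append] using h2
    · intro h
      refine ⟨fun i => ?_, ?_⟩
      · have := h ⟨i, by simp⟩
        simpa [List.getElem_append] using this
      · simpa [List.getElem_append] using h ⟨k, by simp⟩
  · intro i _
    rw [if_neg]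
    intro h
    have := h.length_le
    simp at this
    omega

lemma sameTypeL_iff_occ (x y : List A) :
    sameTypeL k s0 x y ↔ x.length = y.length ∧ ∀ g : List A, g.length = k + 1 →
      occ g (List.ofFn s0 ++ x) = occ g (List.ofFn s0 ++ y) := by
  unfold sameTypeL
  simp only [countL_eq_occ]
  refine and_congr_right fun _ => ⟨fun h g hg => ?_, fun h s a => h _ (by simp)⟩
  obtain ⟨s, a, rfl⟩ : ∃ (s : Fin k → A) (a : A), g = List.ofFn s ++ [a] := by
    refine ⟨fun i => g[(i : ℕ)], g[k], ?_⟩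
    apply List.ext_getElem
    · simp [hg]
    · intro i hi _
      rw [List.getElem_append]
      split_ifs with h'
      · simp
      · have : i = k := by simp at h'; omega
        subst this; simp
  exact h s a

lemma mem_lists [Fintype A] (n : ℕ) (x : List A) : x ∈ lists A n ↔ x.length = n := by
  induction n generalizing x with
  | zero => simp [lists]
  | succ n ih => cases x <;> simp [lists, ih]

lemma mem_sfilter {α : Type*} {p : α → Prop} {s : Finset α} {a : α} :
    a ∈ sfilter p s ↔ a ∈ s ∧ p a := by
  simp [sfilter]

lemma mem_typeClassL [Fintype A] (x y : List A) :
    y ∈ typeClassL k s0 x ↔ x.length = y.length ∧ ∀ g : List A, g.length = k + 1 →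
      occ g (List.ofFn s0 ++ x) = occ g (List.ofFn s0 ++ y) := by
  rw [typeClassL, mem_sfilter, mem_lists, sameTypeL_iff_occ]
  exact ⟨fun h => h.2, fun h => ⟨h.1.symm, h⟩⟩

end Translation

/-- Inserting a fixed word `q` into `w` at the first position where the state `p` is reached is
an injective operation. -/
lemma insert_at_first_visit_injOn {A : Type*} {S p q : List A} {W : Set (List A)} {i : List A → ℕ}
    (hle : ∀ w ∈ W, i w ≤ w.length) (hi : ∀ w ∈ W, p <:+ S ++ w.take (i w))
    (hmin : ∀ w ∈ W, ∀ j < i w, ¬ p <:+ S ++ w.take j) :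
    Set.InjOn (fun w => w.take (i w) ++ (q ++ w.drop (i w))) W := by
  have key : ∀ v ∈ W, ∀ w ∈ W,
      v.take (i v) ++ (q ++ v.drop (i v)) = w.take (i w) ++ (q ++ w.drop (i w)) →
      i w ≤ i v := by
    intro v hv w hw h
    by_contra! hlt
    refine hmin w hw _ hlt ?_
    have h2 := congrArg (List.take (i v)) h
    rw [List.take_append_of_le_length (by simp [hle v hv]), List.take_take,
      List.take_append_of_le_length (by simp; exact ⟨hlt.le, hlt.le.trans (hle w hw)⟩),
      List.take_take, min_self, min_eq_left hlt.le] at h2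
    exact h2 ▸ hi v hv
  intro v hv w hw h
  simp only at h
  have hvw : i v = i w := (key w hw v hv h.symm).antisymm (key v hv w hw h)
  obtain ⟨h1, h2⟩ := List.append_inj h (by
    rw [List.length_take, List.length_take, min_eq_left (hle v hv), min_eq_left (hle w hw), hvw])
  rw [← List.take_append_drop (i v) v, h1, List.append_cancel_left h2, List.take_append_drop]

section Cutting

variable {A : Type*} [DecidableEq A] [Inhabited A] {k : ℕ} {s0 : Fin k → A}

lemma mem_TcutSet_singleton {T : Finset (List A)} {p y : List A} {a b : A} (hp : p.length = k)
    (hmem : y ++ [a] ∈ T) (hz : p <:+ List.ofFn s0 ++ (y ++ [a]))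
    (hb : b :: p <:+ List.ofFn s0 ++ (y ++ [a])) : y ∈ TcutSet k s0 T [b] := by
  refine Finset.mem_image.2 ⟨y ++ [a], mem_sfilter.2 ⟨hmem, by simp, ?_⟩, by simp⟩
  exact (forall_symL_iff_suffix k s0 hp hz (by simp)).2 hb

lemma exists_of_mem_TcutSet_TcutSet {T : Finset (List A)} {p u w : List A} {c : A}
    (hp : p.length = k) (hT : ∀ z ∈ T, p <:+ List.ofFn s0 ++ z) (hu : u.length = k + 1)
    (hw : w ∈ TcutSet k s0 (TcutSet k s0 T [c]) u) :
    ∃ e, w ++ e :: c :: p ∈ T ∧ u <:+ List.ofFn s0 ++ (w ++ [e]) := by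
  obtain ⟨y, hy, rfl⟩ := Finset.mem_image.1 hw
  obtain ⟨hy, huy, hsu⟩ := mem_sfilter.1 hy
  obtain ⟨z, hz, rfl⟩ := Finset.mem_image.1 hy
  obtain ⟨hzT, hz1, hsc⟩ := mem_sfilter.1 hz
  rw [forall_symL_iff_suffix k s0 hp (hT z hzT) hz1] at hsc
  obtain ⟨y, a, rfl⟩ : ∃ y a, z = y ++ [a] :=
    (List.eq_nil_or_concat' z).resolve_left (by rintro rfl; simp at hz1)
  obtain ⟨q, a', hq⟩ : ∃ q a', c :: p = q ++ [a'] :=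
    (List.eq_nil_or_concat' (c :: p)).resolve_left (by simp)
  have hqlen : q.length = k := by
    have := congrArg List.length hq
    simp at this; omega
  have hy' : (y ++ [a]).take ((y ++ [a]).length - [c].length) = y := by simp
  rw [hy'] at huy hsu ⊢
  rw [List.singleton_append, hq, ← List.append_assoc, List.suffix_append_inj_of_length_eq (by simp)] at hsc
  obtain ⟨hqy, ha⟩ := hsc
  obtain rfl : a' = a := by simpa using ha
  rw [forall_symL_iff_suffix k s0 hqlen hqy huy] at hsu
  have hsuf : u ++ c :: p <:+ List.ofFn s0 ++ (y ++ [a']) := by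
    rw [hq, ← List.append_assoc, ← List.append_assoc]
    exact (List.suffix_append_inj_of_length_eq rfl).2 ⟨hsu, rfl⟩
  have hdrop : (y.drop (y.length - u.length)).length = k + 1 := by simp; omega
  have hy := List.take_append_drop (y.length - u.length) y
  generalize y.take (y.length - u.length) = w at hy ⊢
  generalize y.drop (y.length - u.length) = r at hy hdrop
  subst hy
  obtain ⟨e, r', hr⟩ := List.exists_cons_of_ne_nil (l := r ++ [a']) (by simp)
  have hr' : r'.length = (c :: p).length := by
    have := congrArg List.length hr
    simp at this ⊢; omega
  rw [List.append_assoc, hr] at hzT hsuf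
  rw [List.append_cons w, ← List.append_assoc (List.ofFn s0),
    List.suffix_append_inj_of_length_eq hr'.symm] at hsuf
  exact ⟨e, hsuf.2 ▸ hzT, hsuf.1⟩

end Cutting

/-- Let `T1` be a type class of length `n+1`, `b, c ∈ A`,
`T2 = T_b(T1)` and `T3 = T_c(T1)`.  Then there exists `u ∈ A^{k+1}` with
`|T2| ≥ |T_u(T3)|`. -/
theorem small_ancestor {A : Type*} [Fintype A] [DecidableEq A] [Inhabited A]
    (hA : 2 ≤ Fintype.card A) (k : ℕ) (s0 : Fin k → A)
    (x1 : List A) (hx1 : 1 ≤ x1.length) (b c : A) :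
    ∃ u : List A, u.length = k + 1 ∧
      (TcutSet k s0 (TcutSet k s0 (typeClassL k s0 x1) [c]) u).card
        ≤ (TcutSet k s0 (typeClassL k s0 x1) [b]).card := by
  obtain ⟨p, hp, hpx⟩ : ∃ p : List A, p.length = k ∧ p <:+ List.ofFn s0 ++ x1 :=
    ⟨(List.ofFn s0 ++ x1).drop x1.length, by simp, List.drop_suffix _ _⟩
  subst hp
  set S := List.ofFn s0 with hS
  have hSlen : S.length = p.length := by simp [hS]
  set T := typeClassL p.length s0 x1 with hT
  have hTp : ∀ z ∈ T, p <:+ S ++ z := fun z hz =>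
    suffix_of_occ_eq hSlen ((mem_typeClassL _ _ _ _).1 hz).2 hpx
  by_cases hvisit : ∀ w ∈ TcutSet p.length s0 (TcutSet p.length s0 T [c]) (b :: p),
      ∃ j ≤ w.length, p <:+ S ++ w.take j
  · refine ⟨b :: p, by simp, ?_⟩
    have : ∀ w, ∃ j, w ∈ TcutSet p.length s0 (TcutSet p.length s0 T [c]) (b :: p) →
        j ≤ w.length ∧ p <:+ S ++ w.take j ∧ ∀ l < j, ¬ p <:+ S ++ w.take l := by
      classical
      intro w
      by_cases hw : w ∈ TcutSet p.length s0 (TcutSet p.length s0 T [c]) (b :: p)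
      · have hex : ∃ j, p <:+ S ++ w.take j := (hvisit w hw).imp fun _ h => h.2
        obtain ⟨j, hj, hjp⟩ := hvisit w hw
        exact ⟨Nat.find hex, fun _ => ⟨(Nat.find_min' hex hjp).trans hj, Nat.find_spec hex,
          fun l hl => Nat.find_min hex hl⟩⟩
      · exact ⟨0, fun h => absurd h hw⟩
    choose i hi using this
    refine Finset.card_le_card_of_injOn _ ?_ (insert_at_first_visit_injOn (S := S) (p := p)
      (q := c :: p) (i := i) (fun w hw => (hi w hw).1) (fun w hw => (hi w hw).2.1)
      (fun w hw => (hi w hw).2.2))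
    intro w hw
    beta_reduce
    obtain ⟨e, hz, hbp⟩ := exists_of_mem_TcutSet_TcutSet rfl hTp (by simp) hw
    obtain ⟨-, ⟨P, hP⟩, -⟩ := hi w hw
    generalize hw₁ : w.take (i w) = w₁ at hP ⊢
    generalize hw₂ : w.drop (i w) = w₂ at hP ⊢
    obtain rfl : w = w₁ ++ w₂ := by rw [← hw₁, ← hw₂, List.take_append_drop]
    have hbp' : b :: p <:+ p ++ (w₂ ++ [e]) := by
      rw [List.append_assoc, ← List.append_assoc, ← hP, List.append_assoc] at hbp
      exact List.suffix_of_suffix_length_le hbp (List.suffix_append _ _) (by simp)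
    have hend : b :: p <:+ S ++ ((w₁ ++ (c :: p ++ w₂)) ++ [e]) := by
      refine hbp'.trans ⟨S ++ w₁ ++ [c], by simp⟩
    refine mem_TcutSet_singleton (a := e) rfl ?_ ((List.suffix_cons b p).trans hend) hend
    rw [hT, mem_typeClassL] at hz ⊢
    refine ⟨hz.1.trans (by simp; omega), fun g hg => (hz.2 g hg).trans ?_⟩
    have := occ_swap_cycles (P := P) (c := c) hg ((List.suffix_cons b p).trans hbp')
    rw [hP] at this
    simpa [hS] using this
  · push Not at hvisit
    obtain ⟨w, hw, hno⟩ := hvisit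
    have : Nontrivial A := Fintype.one_lt_card_iff_nontrivial.1 hA
    obtain ⟨b', hb⟩ := exists_ne b
    refine ⟨b' :: p, by simp, ?_⟩
    refine (Finset.card_eq_zero.2 ?_).trans_le (Nat.zero_le _)
    refine Finset.eq_empty_of_forall_notMem fun w' hw' => ?_
    obtain ⟨e, hz, hbp⟩ := exists_of_mem_TcutSet_TcutSet rfl hTp (by simp) hw
    obtain ⟨e', hz', V, hV⟩ := exists_of_mem_TcutSet_TcutSet rfl hTp (by simp) hw'
    have hg : (b' :: p).length = p.length + 1 := by simp
    have hsplit : ∀ V v d a, V ++ d :: p = S ++ (v ++ [a]) →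
        occ (b' :: p) (S ++ (v ++ a :: c :: p)) =
          occ (b' :: p) (S ++ (v ++ [a])) + occ (b' :: p) (p ++ c :: p) := by
      intro V v d a h
      have h1 : S ++ (v ++ a :: c :: p) = (V ++ [d]) ++ (p ++ c :: p) := by
        rw [List.append_cons v, ← List.append_assoc S, ← h]; simp
      rw [h1, occ_append_overlap hg, ← h]; simp
    obtain ⟨U, hU⟩ := hbp
    have h0 := occ_cons_eq_zero hSlen hb hno ⟨U, hU⟩
    have h1 := (((mem_typeClassL _ _ _ _).1 hz).2 _ hg).symm.trans
      (((mem_typeClassL _ _ _ _).1 hz').2 _ hg)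
    rw [← hS, hsplit U w b e hU, hsplit V w' b' e' hV, h0, ← hV] at h1
    have := occ_append_right_pos (b' :: p) V
    omega
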